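/- Let S ⊆ [0,∞) be a finite union of disjoint intervals with rational endpoints. Then for every i ∈ ℕ₀, (μ^ℕ × μ^k)({(x,ω) : M_k(S)(x,ω) = i}) converges to e^{−|S|} |S|^i / i! as k → ∞; equivalently, the random variables M_k(S) converge in distribution to a Poisson random variable with mean |S|. -/

import Mathlib

open MeasureTheory Filter

/-- The uniform product measure μ^k on Ω^k, Ω = Fin b: normalized counting measure. -/
noncomputable def muK (b k : ℕ) : Measure (Fin k → Fin b) :=
  ((b : ENNReal) ^ k)⁻¹ • Measure.count

/-- ν is the product measure μ^ℕ of uniform measures on Ω = Fin b over Ω^ℕ: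
every cylinder of length n has measure b^{-n}. -/
def IsUnifProductMeasure (b : ℕ) (ν : Measure (ℕ → Fin b)) : Prop :=
  ∀ (n : ℕ) (w : Fin n → Fin b),
    ν {x | ∀ t : Fin n, x (t : ℕ) = w t} = ((b : ENNReal)⁻¹) ^ n

/-- The word w (of length k) occurs in x at position j (positions numbered from 1):
I_j(x,w) = 1. -/
def OccursAt {b k : ℕ} (x : ℕ → Fin b) (j : ℕ) (w : Fin k → Fin b) : Prop :=
  ∀ t : Fin k, x (j - 1 + (t : ℕ)) = w t

instance {b k : ℕ} (x : ℕ → Fin b) (j : ℕ) (w : Fin k → Fin b) :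
    Decidable (OccursAt x j w) := by unfold OccursAt; infer_instance

/-- M_k^x(S)(w) = Σ_{j ∈ ℕ ∩ b^k S} I_j(x,w): the number of positive integers j with
j/b^k ∈ S at which w occurs in x. -/
noncomputable def Mx (b k : ℕ) (S : Set ℝ) (x : ℕ → Fin b) (w : Fin k → Fin b) : ℕ :=
  {j : ℕ | 1 ≤ j ∧ ((j : ℝ) / (b : ℝ) ^ k) ∈ S ∧ OccursAt x j w}.ncard

/-- Z^λ_{i,k}(x): proportion of words of length k occurring exactly i times
among positions 1 ≤ j ≤ λ b^k of x. -/
noncomputable def Z (b k i : ℕ) (lam : ℝ) (x : ℕ → Fin b) : ℝ :=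
  ((Finset.univ.filter (fun w : Fin k → Fin b =>
      ((Finset.Icc 1 ⌊lam * (b : ℝ) ^ k⌋₊).filter (fun j => OccursAt x j w)).card = i)).card : ℝ)
    / (b : ℝ) ^ k

/-- x is λ-Poisson generic. -/
def LamPoissonGeneric (b : ℕ) (lam : ℝ) (x : ℕ → Fin b) : Prop :=
  ∀ i : ℕ, Tendsto (fun k : ℕ => Z b k i lam x) atTop
    (nhds (Real.exp (-lam) * lam ^ i / (Nat.factorial i : ℝ)))

/-- x is Poisson generic. -/
def PoissonGeneric (b : ℕ) (x : ℕ → Fin b) : Prop :=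
  ∀ lam : ℝ, 0 < lam → LamPoissonGeneric b lam x

/-- S ⊆ [0,∞) is a finite union of pairwise disjoint intervals with rational endpoints. -/
def IsFinRatIntervalUnion (S : Set ℝ) : Prop :=
  ∃ (n : ℕ) (p q : Fin n → ℚ), (∀ m, 0 ≤ p m) ∧
    (Pairwise fun m l : Fin n =>
      Disjoint (Set.Ioo ((p m : ℝ)) ((q m : ℝ))) (Set.Ioo ((p l : ℝ)) ((q l : ℝ)))) ∧
    S = ⋃ m, Set.Ioo ((p m : ℝ)) ((q m : ℝ))

/-- Total variation distance between two laws on ℕ (given as set functions). -/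
noncomputable def dTV (P Q : Set ℕ → ℝ) : ℝ := ⨆ A : Set ℕ, |P A - Q A|

/-- The law on ℕ of M_k(S) under μ^ℕ × μ^k. -/
noncomputable def lawM (b k : ℕ) (ν : Measure (ℕ → Fin b)) (S : Set ℝ) (A : Set ℕ) : ℝ :=
  ((ν.prod (muK b k)) {p : (ℕ → Fin b) × (Fin k → Fin b) | Mx b k S p.1 p.2 ∈ A}).toReal

/-- The law on ℕ of M_k^x(S) under μ^k. -/
noncomputable def lawMx (b k : ℕ) (x : ℕ → Fin b) (S : Set ℝ) (A : Set ℕ) : ℝ :=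
  ((muK b k) {w : Fin k → Fin b | Mx b k S x w ∈ A}).toReal

/-- The Poisson law with mean λ, as a set function on ℕ. -/
noncomputable def poissonLaw (lam : ℝ) (A : Set ℕ) : ℝ :=
  ∑' i : A, Real.exp (-lam) * lam ^ (i : ℕ) / (Nat.factorial (i : ℕ) : ℝ)

open scoped Classical in
/-- The uniform probability of an event in a finite sample space. -/
noncomputable def unifProb {G : Type*} [Fintype G] (A : Set G) : ℝ :=
  (∑ g, if g ∈ A then (1 : ℝ) else 0) / Fintype.card G

open scoped Classical in
/-- The number of indices in `J` whose event contains `g`. -/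
noncomputable def occCount {G : Type*} (J : Finset ℕ) (X : ℕ → Set G) (g : G) : ℕ :=
  (J.filter fun j => g ∈ X j).card

lemma occCount_filter_add {G : Type*} (J : Finset ℕ) (p : ℕ → Prop) [DecidablePred p]
    (X : ℕ → Set G) (g : G) :
    occCount (J.filter p) X g + occCount (J.filter fun j => ¬ p j) X g = occCount J X g := by
  classical
  simp only [occCount, Finset.filter_filter]
  rw [← Finset.card_union_of_disjoint]
  · congr 1
    ext j
    simp only [Finset.mem_union, Finset.mem_filter]
    tauto
  · rw [Finset.disjoint_filter]
    tauto

section UniformProbability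

variable {G : Type*} [Fintype G]

lemma unifProb_nonneg (A : Set G) : 0 ≤ unifProb A := by
  unfold unifProb
  positivity

lemma unifProb_univ [Nonempty G] : unifProb (Set.univ : Set G) = 1 := by
  simp [unifProb]

lemma unifProb_mono {A B : Set G} (h : A ⊆ B) : unifProb A ≤ unifProb B := by
  unfold unifProb
  gcongr with g
  by_cases hA : g ∈ A
  · simp [hA, h hA]
  · simp only [hA, if_false]
    positivity

lemma unifProb_union_le (A B : Set G) : unifProb (A ∪ B) ≤ unifProb A + unifProb B := by
  unfold unifProb
  rw [← add_div, ← Finset.sum_add_distrib]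
  gcongr with g
  by_cases hA : g ∈ A <;> by_cases hB : g ∈ B <;> simp [hA, hB]

lemma unifProb_biUnion_le (J : Finset ℕ) (X : ℕ → Set G) :
    unifProb (⋃ j ∈ J, X j) ≤ ∑ j ∈ J, unifProb (X j) := by
  induction J using Finset.induction_on with
  | empty => simp [unifProb]
  | insert a s ha ih =>
    rw [Finset.sum_insert ha, Finset.set_biUnion_insert]
    exact (unifProb_union_le _ _).trans (by gcongr)

lemma abs_unifProb_sub_le {A B C : Set G} (hA : A ⊆ B ∪ C) (hB : B ⊆ A ∪ C) :
    |unifProb A - unifProb B| ≤ unifProb C := by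
  have h1 := (unifProb_mono hA).trans (unifProb_union_le _ _)
  have h2 := (unifProb_mono hB).trans (unifProb_union_le _ _)
  rw [abs_le]
  constructor <;> linarith

/-- If translations by `s h` shift `φ` by `h` and preserve `A`, then `φ = 0` is independent of `A`
and has probability `1 / |H|`. -/
lemma unifProb_zero_inter [AddCommGroup G] {H : Type*} [AddCommGroup H] [Fintype H]
    (φ : G → H) (s : H → G) (A : Set G) (hφ : ∀ g h, φ (g + s h) = φ g + h)
    (hA : ∀ g h, g + s h ∈ A ↔ g ∈ A) :
    unifProb ({g | φ g = 0} ∩ A) = (Fintype.card H : ℝ)⁻¹ * unifProb A := by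
  classical
  have hc : (Fintype.card H : ℝ) ≠ 0 := by
    exact_mod_cast Fintype.card_ne_zero
  have key : ∀ h : H, (∑ g, if φ g = h ∧ g ∈ A then (1 : ℝ) else 0)
      = ∑ g, if φ g = 0 ∧ g ∈ A then (1 : ℝ) else 0 := by
    intro h
    rw [← Equiv.sum_comp (Equiv.addRight (s h))]
    simp [hφ, hA]
  have tot : (∑ g, if g ∈ A then (1 : ℝ) else 0)
      = Fintype.card H * ∑ g, if φ g = 0 ∧ g ∈ A then (1 : ℝ) else 0 := by
    have : ∑ h : H, (∑ g, if φ g = h ∧ g ∈ A then (1 : ℝ) else 0)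
        = Fintype.card H * ∑ g, if φ g = 0 ∧ g ∈ A then (1 : ℝ) else 0 := by
      simp only [key, Finset.sum_const, Finset.card_univ, nsmul_eq_mul]
    rw [← this, Finset.sum_comm]
    refine Finset.sum_congr rfl fun g _ => ?_
    by_cases hg : g ∈ A <;> simp [hg]
  unfold unifProb
  simp only [Set.mem_inter_iff, Set.mem_ofPred_eq]
  rw [tot]
  field_simp

open scoped Classical in
lemma sum_unifProb_inter (J : Finset ℕ) (X : ℕ → Set G) (A : Set G) :
    ∑ j ∈ J, unifProb (X j ∩ A)
      = (∑ g, if g ∈ A then (occCount J X g : ℝ) else 0) / Fintype.card G := by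
  unfold unifProb occCount
  rw [← Finset.sum_div, Finset.sum_comm]
  congr 1
  refine Finset.sum_congr rfl fun g _ => ?_
  by_cases hg : g ∈ A <;> simp [hg]

lemma sum_unifProb_inter_occCount_eq (J : Finset ℕ) (X : ℕ → Set G) (n : ℕ) :
    ∑ j ∈ J, unifProb (X j ∩ {g | occCount J X g = n})
      = n * unifProb {g | occCount J X g = n} := by
  rw [sum_unifProb_inter, unifProb, ← mul_div_assoc, Finset.mul_sum]
  congr 1
  refine Finset.sum_congr rfl fun g _ => ?_
  by_cases hg : occCount J X g = n <;> simp [hg]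

/-- Markov's inequality for the number of occurring events. -/
lemma mul_unifProb_le_occCount (J : Finset ℕ) (X : ℕ → Set G) (m : ℕ) :
    m * unifProb {g | m ≤ occCount J X g} ≤ ∑ j ∈ J, unifProb (X j) := by
  have h := sum_unifProb_inter J X Set.univ
  simp only [Set.inter_univ, Set.mem_univ, if_true] at h
  rw [h, unifProb, ← mul_div_assoc, Finset.mul_sum]
  gcongr with g
  by_cases hg : m ≤ occCount J X g <;> simp [hg]

lemma sum_range_unifProb_occCount [Nonempty G] (J : Finset ℕ) (X : ℕ → Set G) (m : ℕ) :
    ∑ n ∈ Finset.range m, unifProb {g | occCount J X g = n}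
      = 1 - unifProb {g | m ≤ occCount J X g} := by
  classical
  rw [eq_sub_iff_add_eq, ← unifProb_univ (G := G)]
  unfold unifProb
  rw [← Finset.sum_div, Finset.sum_comm, ← add_div, ← Finset.sum_add_distrib]
  congr 1
  refine Finset.sum_congr rfl fun g _ => ?_
  by_cases hg : m ≤ occCount J X g
  · rw [Finset.sum_eq_zero]
    · simp [hg]
    · intro n hn
      rw [Finset.mem_range] at hn
      simp only [Set.mem_ofPred_eq]
      rw [if_neg (by omega)]
  · rw [Finset.sum_eq_single_of_mem (occCount J X g) (by simpa using hg)]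
    · simp [hg]
    · intro n _ hn
      simpa using hn.symm

/-- The Chen–Stein estimate with local dependence, for the test function `1_{n + 1}`. -/
theorem abs_card_mul_unifProb_sub_le (J : Finset ℕ) (X : ℕ → Set G) (near : ℕ → ℕ → Prop)
    [∀ i, DecidablePred (near i)] (q : ℝ) (D : ℕ) (hq : 0 ≤ q) (hX : ∀ i ∈ J, unifProb (X i) = q)
    (hpair : ∀ i ∈ J, ∀ j ∈ J, i ≠ j → unifProb (X i ∩ X j) = q ^ 2)
    (hself : ∀ i, near i i) (hD : ∀ i ∈ J, (J.filter (near i)).card ≤ D) (n : ℕ)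
    (hind : ∀ i ∈ J,
      unifProb (X i ∩ {g | occCount (J.filter fun j => ¬ near i j) X g = n})
        = q * unifProb {g | occCount (J.filter fun j => ¬ near i j) X g = n}) :
    |J.card * q * unifProb {g | occCount J X g = n}
      - (n + 1) * unifProb {g | occCount J X g = n + 1}| ≤ J.card * (2 * D * q ^ 2) := by
  classical
  have hs := sum_unifProb_inter_occCount_eq J X (n + 1)
  push_cast at hs
  rw [← hs]
  have hc : (J.card : ℝ) * q * unifProb {g | occCount J X g = n}
      = ∑ _i ∈ J, q * unifProb {g | occCount J X g = n} := by
    simp [mul_assoc]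
  rw [hc, ← Finset.sum_sub_distrib]
  refine (Finset.abs_sum_le_sum_abs _ _).trans ?_
  rw [← nsmul_eq_mul]
  refine Finset.sum_le_card_nsmul _ _ _ fun i hi => ?_
  set V : G → ℕ := fun g => occCount (J.filter fun j => ¬ near i j) X g with hV
  set U : G → ℕ := fun g => occCount (J.filter fun j => near i j) X g with hU
  have hUV : ∀ g, U g + V g = occCount J X g := fun g => occCount_filter_add J (near i) X g
  have hDi : ((J.filter (near i)).card : ℝ) ≤ D := by exact_mod_cast hD i hi
  have e1 : |unifProb {g | V g = n} - unifProb {g | occCount J X g = n}| ≤ D * q := by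
    refine (abs_unifProb_sub_le (C := ⋃ j ∈ J.filter (near i), X j) ?_ ?_).trans ?_
    all_goals try
      intro g hg
      by_cases h0 : U g = 0
      · left
        have := hUV g
        simp only [Set.mem_ofPred_eq] at hg ⊢
        omega
      · right
        obtain ⟨j, hj⟩ := Finset.card_ne_zero.mp h0
        rw [Finset.mem_filter] at hj
        exact Set.mem_biUnion hj.1 hj.2
    refine (unifProb_biUnion_le _ _).trans ?_
    rw [Finset.sum_congr rfl fun j hj => hX j (Finset.mem_filter.mp hj).1, Finset.sum_const,
      nsmul_eq_mul]
    gcongr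
  have e2 : |unifProb (X i ∩ {g | V g = n}) - unifProb (X i ∩ {g | occCount J X g = n + 1})|
      ≤ D * q ^ 2 := by
    refine (abs_unifProb_sub_le
      (C := ⋃ j ∈ (J.filter (near i)).erase i, X i ∩ X j) ?_ ?_).trans ?_
    all_goals try
      rintro g ⟨hgi, hg⟩
      have hmem : i ∈ (J.filter (near i)).filter fun j => g ∈ X j := by
        simp [hi, hself, hgi]
      by_cases h0 : U g = 1
      · left
        have := hUV g
        refine ⟨hgi, ?_⟩
        simp only [Set.mem_ofPred_eq] at hg ⊢
        omega
      · right
        have hpos : 0 < U g := Finset.card_pos.mpr ⟨i, hmem⟩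
        have h1 : 1 < U g := by omega
        obtain ⟨j, hj, hji⟩ := Finset.exists_mem_ne h1 i
        rw [Finset.mem_filter] at hj
        exact Set.mem_biUnion (Finset.mem_coe.mpr (Finset.mem_erase.mpr ⟨hji, hj.1⟩)) ⟨hgi, hj.2⟩
    refine (unifProb_biUnion_le _ _).trans ?_
    rw [Finset.sum_congr rfl fun j hj => hpair i hi j
      (Finset.mem_filter.mp (Finset.mem_erase.mp hj).2).1 (Finset.mem_erase.mp hj).1.symm,
      Finset.sum_const, nsmul_eq_mul]
    have : (((J.filter (near i)).erase i).card : ℝ) ≤ (J.filter (near i)).card := by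
      exact_mod_cast Finset.card_erase_le
    gcongr
    exact_mod_cast this.trans hDi
  rw [hind i hi] at e2
  rw [abs_le] at e1 e2 ⊢
  constructor <;> nlinarith [e1.1, e1.2, e2.1, e2.2]

end UniformProbability

/-- A Poisson limit criterion: asymptotically the Poisson recursion holds, and no mass escapes. -/
theorem tendsto_poisson_of_recursion (p : ℕ → ℕ → ℝ) (a : ℕ → ℝ) (lam C : ℝ)
    (hp : ∀ k n, 0 ≤ p k n) (ha : Tendsto a atTop (nhds lam))
    (hsum : ∀ k m, ∑ n ∈ Finset.range m, p k n ≤ 1)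
    (htail : ∀ k m : ℕ, m * (1 - ∑ n ∈ Finset.range m, p k n) ≤ C)
    (hrec : ∀ n : ℕ,
      Tendsto (fun k => a k * p k n - (n + 1) * p k (n + 1)) atTop (nhds 0)) (i : ℕ) :
    Tendsto (fun k => p k i) atTop (nhds (Real.exp (-lam) * lam ^ i / (i.factorial : ℝ))) := by
  have hle : ∀ k n, p k n ≤ 1 := fun k n =>
    (Finset.single_le_sum (fun j _ => hp k j) (Finset.self_mem_range_succ n)).trans
      (hsum k (n + 1))
  have hrel : ∀ n : ℕ,
      Tendsto (fun k => p k n - p k 0 * (lam ^ n / n.factorial)) atTop (nhds 0) := by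
    intro n
    induction n with
    | zero => simp
    | succ n ih =>
      have hz : Tendsto (fun k => (a k - lam) * p k n) atTop (nhds 0) := by
        have h0 : Tendsto (fun k => a k - lam) atTop (nhds 0) := by
          simpa using ha.sub_const lam
        refine squeeze_zero_norm (fun k => ?_) (by simpa using h0.norm)
        rw [norm_mul]
        refine mul_le_of_le_one_right (norm_nonneg _) ?_
        rw [Real.norm_of_nonneg (hp k n)]
        exact hle k n
      have h := ((hz.sub (hrec n)).add (ih.const_mul lam)).div_const ((n : ℝ) + 1)
      simp only [sub_zero, mul_zero, add_zero, zero_div] at h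
      refine h.congr fun k => ?_
      have hn : (n : ℝ) + 1 ≠ 0 := by positivity
      have hf : (n.factorial : ℝ) ≠ 0 := by positivity
      rw [Nat.factorial_succ]
      push_cast
      field_simp
      ring
  have hexp : Tendsto (fun m => ∑ n ∈ Finset.range m, lam ^ n / (n.factorial : ℝ)) atTop
      (nhds (Real.exp lam)) := by
    rw [Real.exp_eq_exp_ℝ]
    exact (NormedSpace.expSeries_div_hasSum_exp lam).tendsto_sum_nat
  have h0 : Tendsto (fun k => p k 0 * Real.exp lam) atTop (nhds 1) := by
    rw [Metric.tendsto_atTop]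
    intro ε hε
    have hC : Tendsto (fun m : ℕ => C / m) atTop (nhds 0) := tendsto_const_div_atTop_nhds_zero_nat C
    obtain ⟨m, hm1, hm2, hm3⟩ := ((Metric.tendsto_nhds.mp hexp (ε / 3) (by positivity)).and
      ((hC.eventually_lt_const (show (0 : ℝ) < ε / 3 by positivity)).and
        (eventually_gt_atTop 0))).exists
    have hfin : Tendsto (fun k => ∑ n ∈ Finset.range m,
        (p k n - p k 0 * (lam ^ n / n.factorial))) atTop (nhds 0) := by
      simpa using tendsto_finsetSum (Finset.range m) fun n _ => hrel n
    obtain ⟨K, hK⟩ := Metric.tendsto_atTop.mp hfin (ε / 3) (by positivity)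
    refine ⟨K, fun k hk => ?_⟩
    have h1 := hK k hk
    rw [Finset.sum_sub_distrib, ← Finset.mul_sum] at h1
    rw [Real.dist_eq] at hm1 h1 ⊢
    set s := ∑ n ∈ Finset.range m, lam ^ n / (n.factorial : ℝ)
    set t := ∑ n ∈ Finset.range m, p k n
    have ht : 1 - t ≤ C / m := by
      rw [le_div_iff₀ (by exact_mod_cast hm3), mul_comm]
      exact htail k m
    have ht1 : t ≤ 1 := hsum k m
    have hsm : |p k 0 * (s - Real.exp lam)| ≤ |s - Real.exp lam| := by
      rw [abs_mul, abs_of_nonneg (hp k 0)]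
      exact mul_le_of_le_one_left (abs_nonneg _) (hle k 0)
    have h3 := lt_of_le_of_lt hsm hm1
    rw [mul_sub] at h3
    rw [abs_lt] at h1 h3 ⊢
    constructor <;> linarith [h1.1, h1.2, h3.1, h3.2]
  have h0' : Tendsto (fun k => p k 0) atTop (nhds (Real.exp (-lam))) := by
    have := h0.mul_const (Real.exp (-lam))
    simpa [mul_assoc, ← Real.exp_add] using this
  have := (hrel i).add (h0'.mul_const (lam ^ i / (i.factorial : ℝ)))
  simpa [mul_div_assoc] using this

/-- Extension of a finite word by zeros. -/
def extendZero {b L : ℕ} [NeZero b] (u : Fin L → Fin b) (n : ℕ) : Fin b :=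
  if h : n < L then u ⟨n, h⟩ else 0

/-- The event that the word occurs at position `j`, for a word of length `k` and a text of
length `L`. -/
def occSet (b k L : ℕ) [NeZero b] (j : ℕ) : Set ((Fin L → Fin b) × (Fin k → Fin b)) :=
  {g | OccursAt (extendZero g.1) j g.2}

/-- A solution `x` of the recursion `x n = x (n - d) - h (n - c)` for `n ≥ c`. -/
def shiftSol {R : Type*} [AddGroup R] (c d : ℕ) (h : ℕ → R) (n : ℕ) : R :=
  if c ≤ n ∧ 0 < d ∧ 0 < n then shiftSol c d h (n - d) - h (n - c) else 0
termination_by n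
decreasing_by omega

lemma exists_shift_eq_add_of_lt {R : Type*} [AddGroup R] {a c : ℕ} (hac : a < c) (h : ℕ → R) :
    ∃ x : ℕ → R, ∀ t, x (a + t) = x (c + t) + h t := by
  refine ⟨shiftSol c (c - a) h, fun t => ?_⟩
  rw [shiftSol.eq_def c (c - a) h (c + t), if_pos (by omega)]
  rw [show c + t - (c - a) = a + t by omega, show c + t - c = t by omega, sub_add_cancel]

lemma exists_shift_eq_add {R : Type*} [AddGroup R] {a c : ℕ} (hac : a ≠ c) (h : ℕ → R) :
    ∃ x : ℕ → R, ∀ t, x (a + t) = x (c + t) + h t := by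
  rcases lt_or_gt_of_ne hac with hlt | hlt
  · exact exists_shift_eq_add_of_lt hlt h
  · obtain ⟨x, hx⟩ := exists_shift_eq_add_of_lt hlt (-h)
    exact ⟨x, fun t => by rw [hx t]; simp⟩

lemma occursAt_congr {b k : ℕ} {x y : ℕ → Fin b} {j : ℕ} {w : Fin k → Fin b}
    (h : ∀ t < k, x (j - 1 + t) = y (j - 1 + t)) : OccursAt x j w ↔ OccursAt y j w :=
  forall_congr' fun t => by rw [h t t.2]

section Words

variable {b k L : ℕ} [NeZero b]

lemma extendZero_add_restrict (u : Fin L → Fin b) (c : ℕ → Fin b) {n : ℕ} (hn : n < L) :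
    extendZero (u + fun t : Fin L => c t) n = extendZero u n + c n := by
  simp [extendZero, hn]

/-- If the text and the word can be translated so as to shift the discrepancy at position `j`
arbitrarily while preserving `A`, then the occurrence at `j` is independent of `A`. -/
lemma unifProb_occSet_inter {j : ℕ} (hj : j - 1 + k ≤ L)
    (A : Set ((Fin L → Fin b) × (Fin k → Fin b)))
    (x : (Fin k → Fin b) → ℕ → Fin b) (w : (Fin k → Fin b) → Fin k → Fin b)
    (hs : ∀ h (t : Fin k), x h (j - 1 + t) = w h t + h t)
    (hA : ∀ g h, g + ((fun t : Fin L => x h t), w h) ∈ A ↔ g ∈ A) :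
    unifProb (occSet b k L j ∩ A) = ((b : ℝ) ^ k)⁻¹ * unifProb A := by
  have h := unifProb_zero_inter
    (fun g : (Fin L → Fin b) × (Fin k → Fin b) =>
      fun t : Fin k => extendZero g.1 (j - 1 + t) - g.2 t)
    (fun h => ((fun t : Fin L => x h t), w h)) A ?_ hA
  · have e : occSet b k L j = {g | (fun t : Fin k => extendZero g.1 (j - 1 + t) - g.2 t) = 0} := by
      ext g
      simp [occSet, OccursAt, funext_iff, sub_eq_zero]
    rw [e, h]
    simp
  · intro g h
    funext t
    have ht := t.2
    simp only [Prod.fst_add, Prod.snd_add, Pi.add_apply]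
    rw [extendZero_add_restrict _ _ (by omega), hs]
    abel

lemma unifProb_occSet_inter_far {j : ℕ} (hj : j - 1 + k ≤ L) (J : Finset ℕ)
    (hJ : ∀ i ∈ J, i - 1 + k ≤ L) (hfar : ∀ i ∈ J, i - 1 + k ≤ j - 1 ∨ j - 1 + k ≤ i - 1)
    (n : ℕ) :
    unifProb (occSet b k L j ∩ {g | occCount J (occSet b k L) g = n})
      = ((b : ℝ) ^ k)⁻¹ * unifProb {g | occCount J (occSet b k L) g = n} := by
  classical
  refine unifProb_occSet_inter hj _
    (fun h n => if j - 1 ≤ n then extendZero h (n - (j - 1)) else 0) (fun _ => 0) ?_ ?_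
  · intro h t
    simp [extendZero]
  · intro g h
    simp only [Set.mem_ofPred_eq]
    have : occCount J (occSet b k L) (g + ((fun t : Fin L =>
        if j - 1 ≤ (t : ℕ) then extendZero h (t - (j - 1)) else 0), 0))
        = occCount J (occSet b k L) g := by
      unfold occCount
      congr 1
      refine Finset.filter_congr fun i hi => ?_
      simp only [occSet, Set.mem_ofPred_eq, Prod.fst_add, Prod.snd_add, add_zero]
      refine occursAt_congr fun t ht => ?_
      have h1 := hJ i hi
      have h2 := hfar i hi
      rw [extendZero_add_restrict g.1
        (fun n => if j - 1 ≤ n then extendZero h (n - (j - 1)) else 0) (by omega)]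
      rcases h2 with h2 | h2
      · rw [if_neg (by omega), add_zero]
      · simp only [extendZero]
        rw [dif_neg (show ¬ i - 1 + t - (j - 1) < k by omega)]
        simp
    rw [this]

lemma unifProb_occSet {j : ℕ} (hj : j - 1 + k ≤ L) :
    unifProb (occSet b k L j) = ((b : ℝ) ^ k)⁻¹ := by
  have h := unifProb_occSet_inter_far (b := b) hj ∅ (by simp) (by simp) 0
  simpa [occCount, unifProb_univ] using h

lemma unifProb_occSet_inter_occSet {i j : ℕ} (hi : i - 1 + k ≤ L) (hj : j - 1 + k ≤ L)
    (hij : i - 1 ≠ j - 1) :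
    unifProb (occSet b k L i ∩ occSet b k L j) = (((b : ℝ) ^ k)⁻¹) ^ 2 := by
  choose x hx using fun h : Fin k → Fin b => exists_shift_eq_add hij (extendZero h)
  rw [unifProb_occSet_inter hi _ x (fun h t => x h (j - 1 + t)), unifProb_occSet hj, sq]
  · intro h t
    rw [hx]
    simp [extendZero]
  · intro g h
    refine forall_congr' fun t => ?_
    have ht := t.2
    simp only [Prod.fst_add, Prod.snd_add, Pi.add_apply]
    rw [extendZero_add_restrict _ _ (by omega), add_left_inj]

lemma abs_card_mul_unifProb_occSet_sub_le (hk : 0 < k) (J : Finset ℕ)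
    (hJ1 : ∀ j ∈ J, 1 ≤ j) (hJ : ∀ j ∈ J, j - 1 + k ≤ L) (n : ℕ) :
    |J.card * ((b : ℝ) ^ k)⁻¹ * unifProb {g | occCount J (occSet b k L) g = n}
      - (n + 1) * unifProb {g | occCount J (occSet b k L) g = n + 1}|
      ≤ J.card * (2 * (2 * k : ℕ) * (((b : ℝ) ^ k)⁻¹) ^ 2) := by
  refine abs_card_mul_unifProb_sub_le J (occSet b k L) (fun i j => j < i + k ∧ i < j + k) _ _
    (by positivity) (fun i hi => unifProb_occSet (hJ i hi)) ?_ (fun i => by omega) ?_ n ?_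
  · intro i hi j hj hij
    have h1 := hJ1 i hi
    have h2 := hJ1 j hj
    exact unifProb_occSet_inter_occSet (hJ i hi) (hJ j hj) (by omega)
  · intro i _
    calc _ ≤ (Finset.Ico (i + 1 - k) (i + k)).card := by
          refine Finset.card_le_card fun j hj => ?_
          rw [Finset.mem_filter] at hj
          rw [Finset.mem_Ico]
          omega
      _ ≤ 2 * k := by
          rw [Nat.card_Ico]
          omega
  · intro i hi
    refine unifProb_occSet_inter_far (hJ i hi) _ (fun j hj => hJ j (Finset.mem_filter.mp hj).1) ?_ n
    intro j hj
    rw [Finset.mem_filter] at hj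
    have h1 := hJ1 i hi
    have h2 := hJ1 j hj.1
    omega

/-- The law of a finite initial segment of the text together with the word is uniform. -/
lemma prod_muK_preimage {ν : Measure (ℕ → Fin b)} (hν : IsUnifProductMeasure b ν)
    (A : Set ((Fin L → Fin b) × (Fin k → Fin b))) :
    ((ν.prod (muK b k)) ((fun p : (ℕ → Fin b) × (Fin k → Fin b) =>
      ((fun t : Fin L => p.1 t), p.2)) ⁻¹' A)).toReal = unifProb A := by
  classical
  have hb0 : (b : ENNReal) ≠ 0 := by exact_mod_cast NeZero.ne b
  set f : (ℕ → Fin b) × (Fin k → Fin b) → (Fin L → Fin b) × (Fin k → Fin b) :=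
    fun p => ((fun t : Fin L => p.1 t), p.2) with hf
  have hfm : Measurable f := by
    refine Measurable.prodMk (measurable_pi_lambda _ fun t => ?_) measurable_snd
    exact (measurable_pi_apply _).comp measurable_fst
  have : IsFiniteMeasure (muK b k) := by
    unfold muK
    exact Measure.smul_finite _ (by simp [hb0])
  have hsing : ∀ g, (ν.prod (muK b k)) (f ⁻¹' {g})
      = ((b : ENNReal)⁻¹) ^ L * ((b : ENNReal) ^ k)⁻¹ := by
    intro g
    have e : f ⁻¹' {g} = {x | ∀ t : Fin L, x (t : ℕ) = g.1 t} ×ˢ {g.2} := by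
      ext p
      simp [hf, Prod.ext_iff, funext_iff]
    rw [e, Measure.prod_prod, hν L g.1]
    simp [muK]
  have h := sum_measure_preimage_singleton (μ := ν.prod (muK b k)) (f := f) A.toFinset
    (fun y _ => hfm (measurableSet_singleton y))
  rw [Set.coe_toFinset] at h
  rw [← h]
  simp only [hsing, Finset.sum_const, nsmul_eq_mul]
  simp [unifProb, ENNReal.toReal_mul, Set.toFinset_card, Fintype.card_subtype]
  field_simp

lemma Mx_eq_occCount {S : Set ℝ} {J : Finset ℕ}
    (hJS : ∀ j : ℕ, j ∈ J ↔ 1 ≤ j ∧ (j : ℝ) / (b : ℝ) ^ k ∈ S) (hJ : ∀ j ∈ J, j - 1 + k ≤ L)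
    (x : ℕ → Fin b) (w : Fin k → Fin b) :
    Mx b k S x w = occCount J (occSet b k L) ((fun t : Fin L => x t), w) := by
  classical
  unfold Mx occCount
  rw [← Set.ncard_coe_finset]
  congr 1
  ext j
  simp only [Set.mem_ofPred_eq, Finset.coe_filter, hJS, and_assoc]
  refine and_congr_right fun h1 => and_congr_right fun h2 => ?_
  have h3 := hJ j ((hJS j).mpr ⟨h1, h2⟩)
  refine occursAt_congr fun t ht => ?_
  simp [extendZero, show j - 1 + t < L by omega]

end Words

section Intervals

lemma card_Ioo_floor_ceil_bounds {A B : ℝ} (hA : 0 ≤ A) :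
    |((Finset.Ioo ⌊A⌋₊ ⌈B⌉₊).card : ℝ) - max (B - A) 0| ≤ 1 := by
  rw [Nat.card_Ioo]
  rcases le_or_gt B A with h | h
  · have : ⌈B⌉₊ ≤ ⌊A⌋₊ + 1 :=
      Nat.ceil_le.mpr (by push_cast; linarith [Nat.lt_floor_add_one A])
    rw [show ⌈B⌉₊ - ⌊A⌋₊ - 1 = 0 by omega, max_eq_right (by linarith)]
    simp
  · have h1 : ⌊A⌋₊ < ⌈B⌉₊ := Nat.lt_ceil.mpr ((Nat.floor_le hA).trans_lt h)
    rw [Nat.sub_sub, Nat.cast_sub h1, max_eq_left (by linarith)]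
    push_cast
    rw [abs_le]
    have := Nat.lt_floor_add_one A
    have := Nat.floor_le hA
    have := Nat.le_ceil B
    have := Nat.ceil_lt_add_one (hA.trans h.le)
    constructor <;> linarith

/-- The integer points of the dilates of `S` have asymptotic density `|S|`. -/
lemma exists_finset_dilate {b : ℕ} (hb : 2 ≤ b) {S : Set ℝ} (hS : IsFinRatIntervalUnion S) :
    ∃ J : ℕ → Finset ℕ, (∀ k j, j ∈ J k ↔ 1 ≤ j ∧ (j : ℝ) / (b : ℝ) ^ k ∈ S) ∧
      Tendsto (fun k => (J k).card * ((b : ℝ) ^ k)⁻¹) atTop (nhds (volume S).toReal) := by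
  classical
  obtain ⟨n, p, q, hp, hdisj, rfl⟩ := hS
  have hb1 : (1 : ℝ) < b := by exact_mod_cast hb
  have hpos : ∀ k : ℕ, (0 : ℝ) < (b : ℝ) ^ k := fun k => by positivity
  have hp' : ∀ m, (0 : ℝ) ≤ p m := fun m => by exact_mod_cast hp m
  let I : ℕ → Fin n → Finset ℕ := fun k m =>
    Finset.Ioo ⌊(p m : ℝ) * (b : ℝ) ^ k⌋₊ ⌈(q m : ℝ) * (b : ℝ) ^ k⌉₊
  have hI : ∀ k m j, j ∈ I k m ↔ (j : ℝ) / (b : ℝ) ^ k ∈ Set.Ioo (p m : ℝ) (q m : ℝ) := by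
    intro k m j
    rw [Finset.mem_Ioo, Nat.floor_lt (mul_nonneg (hp' m) (hpos k).le), Nat.lt_ceil, Set.mem_Ioo,
      lt_div_iff₀ (hpos k), div_lt_iff₀ (hpos k)]
  refine ⟨fun k => Finset.univ.biUnion (I k), fun k j => ?_, ?_⟩
  · simp only [Finset.mem_biUnion, Finset.mem_univ, true_and, hI, Set.mem_iUnion]
    refine ⟨fun ⟨m, hm⟩ => ⟨?_, m, hm⟩, fun h => h.2⟩
    rw [Nat.one_le_iff_ne_zero]
    rintro rfl
    have := hm.1
    simp only [Nat.cast_zero, zero_div] at this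
    linarith [hp' m]
  · have hvol : (volume (⋃ m, Set.Ioo (p m : ℝ) (q m : ℝ))).toReal
        = ∑ m, max ((q m : ℝ) - p m) 0 := by
      rw [measure_iUnion hdisj (fun m => measurableSet_Ioo), tsum_fintype,
        ENNReal.toReal_sum (by simp)]
      simp [Real.volume_Ioo, ENNReal.toReal_ofReal']
    have hcard : ∀ k, (Finset.univ.biUnion (I k)).card = ∑ m, (I k m).card := by
      intro k
      refine Finset.card_biUnion fun m _ l _ hml => Finset.disjoint_left.mpr fun j hm hl => ?_
      exact Set.disjoint_left.mp (hdisj hml) ((hI k m j).mp hm) ((hI k l j).mp hl)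
    rw [hvol]
    simp only [hcard, Nat.cast_sum, Finset.sum_mul]
    refine tendsto_finsetSum _ fun m _ => ?_
    rw [tendsto_iff_norm_sub_tendsto_zero]
    have hlim : Tendsto (fun k : ℕ => ((b : ℝ) ^ k)⁻¹) atTop (nhds 0) :=
      tendsto_inv_atTop_zero.comp (tendsto_pow_atTop_atTop_of_one_lt hb1)
    refine squeeze_zero (fun _ => norm_nonneg _) (fun k => ?_) hlim
    have h := card_Ioo_floor_ceil_bounds (A := (p m : ℝ) * (b : ℝ) ^ k)
      (B := (q m : ℝ) * (b : ℝ) ^ k) (mul_nonneg (hp' m) (hpos k).le)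
    have e : max ((q m : ℝ) * (b : ℝ) ^ k - p m * (b : ℝ) ^ k) 0
        = max ((q m : ℝ) - p m) 0 * (b : ℝ) ^ k := by
      rw [max_mul_of_nonneg _ _ (hpos k).le, sub_mul, zero_mul]
    rw [e] at h
    have e2 : ((I k m).card : ℝ) * ((b : ℝ) ^ k)⁻¹ - max ((q m : ℝ) - p m) 0
        = (((I k m).card : ℝ) - max ((q m : ℝ) - p m) 0 * (b : ℝ) ^ k) * ((b : ℝ) ^ k)⁻¹ := by
      rw [sub_mul, mul_inv_cancel_right₀ (hpos k).ne']
    rw [e2, norm_mul, Real.norm_eq_abs, Real.norm_of_nonneg (inv_nonneg.mpr (hpos k).le)]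
    exact mul_le_of_le_one_left (inv_nonneg.mpr (hpos k).le) h

end Intervals

theorem stmt3 (b : ℕ) (hb : 2 ≤ b) (ν : Measure (ℕ → Fin b))
    (hν : IsUnifProductMeasure b ν) (S : Set ℝ) (hS : IsFinRatIntervalUnion S) (i : ℕ) :
    Tendsto (fun k : ℕ =>
        ((ν.prod (muK b k))
          {p : (ℕ → Fin b) × (Fin k → Fin b) | Mx b k S p.1 p.2 = i}).toReal)
      atTop
      (nhds (Real.exp (-(volume S).toReal) * (volume S).toReal ^ i /
        (Nat.factorial i : ℝ))) := by
  have : NeZero b := ⟨by omega⟩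
  obtain ⟨J, hJS, hlim⟩ := exists_finset_dilate hb hS
  have hb1 : (1 : ℝ) < b := by exact_mod_cast hb
  let L : ℕ → ℕ := fun k => (J k).sup id + k
  have hJL : ∀ k, ∀ j ∈ J k, j - 1 + k ≤ L k := by
    intro k j hj
    have : j ≤ (J k).sup id := Finset.le_sup (f := id) hj
    simp only [L]
    omega
  have hlaw : ∀ k, ((ν.prod (muK b k))
      {p : (ℕ → Fin b) × (Fin k → Fin b) | Mx b k S p.1 p.2 = i}).toReal
      = unifProb {g | occCount (J k) (occSet b k (L k)) g = i} := by
    intro k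
    rw [← prod_muK_preimage hν]
    congr 2
    ext p
    simp [Mx_eq_occCount (hJS k) (hJL k)]
  simp only [hlaw]
  obtain ⟨C, hC⟩ := hlim.bddAbove_range
  refine tendsto_poisson_of_recursion
    (fun k n => unifProb {g | occCount (J k) (occSet b k (L k)) g = n})
    _ _ C (fun k n => unifProb_nonneg _) hlim (fun k m => ?_) (fun k m => ?_) (fun n => ?_) i
  · rw [sum_range_unifProb_occCount]
    linarith [unifProb_nonneg {g | m ≤ occCount (J k) (occSet b k (L k)) g}]
  · rw [sum_range_unifProb_occCount, sub_sub_cancel]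
    refine (mul_unifProb_le_occCount _ _ _).trans ?_
    rw [Finset.sum_congr rfl fun j hj => unifProb_occSet (hJL k j hj), Finset.sum_const,
      nsmul_eq_mul]
    exact hC ⟨k, rfl⟩
  · have hz : Tendsto (fun k : ℕ => ((J k).card * ((b : ℝ) ^ k)⁻¹)
        * (4 * (k * ((b : ℝ)⁻¹) ^ k))) atTop (nhds 0) := by
      have h := (tendsto_self_mul_const_pow_of_lt_one (r := (b : ℝ)⁻¹) (by positivity)
        (inv_lt_one_of_one_lt₀ hb1)).const_mul 4
      simpa using hlim.mul h
    refine squeeze_zero_norm' ?_ hz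
    filter_upwards [eventually_gt_atTop 0] with k hk
    refine (abs_card_mul_unifProb_occSet_sub_le hk (J k)
      (fun j hj => ((hJS k j).mp hj).1) (hJL k) n).trans (le_of_eq ?_)
    rw [inv_pow]
    push_cast
    ring
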